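/- Let G be a finite simple graph and let v be a vertex of degree exactly 5 lying on exactly one pendent triangle v t1 t2 (t1, t2 distinct degree-2 vertices with t1~t2 and both adjacent to v), with remaining neighbors u1, u2, u3, where each of u1, u2, u3 has degree exactly 2 in G and does not lie on a pendent triangle (i.e., each u_i is a 2-vertex whose two neighbors are non-adjacent). If the graph G − {v, t1, t2, u1, u2, u3} has an FII-partition, then G has an FII-partition. -/

import Mathlib

open scoped Classical

/-- `S` is a *2-independent set* of `G`: any two distinct vertices of `S` are at
distance at least 3 in `G`, i.e. they are non-adjacent and have no common neighbor. -/
def TwoIndepSet {W : Type*} (G : SimpleGraph W) (S : Set W) : Prop :=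
  ∀ u ∈ S, ∀ v ∈ S, u ≠ v → ¬G.Adj u v ∧ ∀ w, ¬(G.Adj u w ∧ G.Adj w v)

/-- `F ⊔ A ⊔ B` is an *FII-partition* of `G`: the three sets partition the vertex set,
the subgraph induced on `F` is a forest (acyclic), and `A`, `B` are 2-independent sets. -/
def IsFIIPartition {W : Type*} (G : SimpleGraph W) (F A B : Set W) : Prop :=
  (∀ v, v ∈ F ∨ v ∈ A ∨ v ∈ B) ∧
    Disjoint F A ∧ Disjoint F B ∧ Disjoint A B ∧
    (G.induce F).IsAcyclic ∧ TwoIndepSet G A ∧ TwoIndepSet G B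

/-- `G` admits some FII-partition. -/
def HasFIIPartition {W : Type*} (G : SimpleGraph W) : Prop :=
  ∃ F A B, IsFIIPartition G F A B

theorem SimpleGraph.isAcyclic_induce_iff {W : Type*} {G : SimpleGraph W} {F : Set W} :
    (G.induce F).IsAcyclic ↔
      ∀ ⦃a⦄ (p : G.Walk a a), p.IsCycle → ¬∀ x ∈ p.support, x ∈ F := by
  constructor
  · intro h a p hp hF
    refine h (p.induce F hF) (SimpleGraph.Walk.IsCycle.of_map
      (f := (SimpleGraph.Embedding.induce F).toHom) ?_)
    rwa [SimpleGraph.Walk.map_induce]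
  · intro h a p hp
    refine h (p.map (SimpleGraph.Embedding.induce F).toHom)
      (hp.map (SimpleGraph.Embedding.induce (G := G) F).injective) fun x hx => ?_
    rw [SimpleGraph.Walk.support_map, List.mem_map] at hx
    obtain ⟨y, -, rfl⟩ := hx
    exact y.2

/-- Adding a vertex with at most one neighbor in `F` to an induced forest on `F` keeps it a
forest. -/
theorem SimpleGraph.IsAcyclic.induce_insert {W : Type*} {G : SimpleGraph W} {F : Set W} {x : W}
    (hF : (G.induce F).IsAcyclic)
    (hx : ∀ a ∈ F, ∀ b ∈ F, G.Adj x a → G.Adj x b → a = b) :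
    (G.induce (insert x F)).IsAcyclic := by
  rw [SimpleGraph.isAcyclic_induce_iff] at hF ⊢
  intro a p hp hsupp
  by_cases hxp : x ∈ p.support
  · have hc := hp.rotate hxp
    have hmem : ∀ y ∈ (p.rotate x hxp).support, G.Adj x y → y ∈ F := fun y hy hadj =>
      (hsupp y ((SimpleGraph.Walk.mem_support_rotate_iff ..).1 hy)).resolve_left hadj.ne'
    have hs := (p.rotate x hxp).adj_snd hc.not_nil
    have hl := ((p.rotate x hxp).adj_penultimate hc.not_nil).symm
    exact hc.snd_ne_penultimate (hx _ (hmem _ (SimpleGraph.Walk.getVert_mem_support _ _) hs)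
      _ (hmem _ (SimpleGraph.Walk.getVert_mem_support _ _) hl) hs hl)
  · exact hF p hp fun y hy =>
      (hsupp y hy).resolve_left fun h => hxp (h ▸ hy)

theorem SimpleGraph.IsAcyclic.induce_image_val {W : Type*} {G : SimpleGraph W} {U : Set W}
    {F : Set U} (hF : ((G.induce U).induce F).IsAcyclic) :
    (G.induce (Subtype.val '' F)).IsAcyclic := by
  have hval : ∀ x : ↥(Subtype.val '' F), ∃ h : (x : W) ∈ U, (⟨x, h⟩ : U) ∈ F := by
    rintro ⟨_, y, hy, rfl⟩
    exact ⟨y.2, hy⟩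
  exact hF.comap (G := G.induce (Subtype.val '' F))
    ⟨fun x => ⟨⟨x, (hval x).1⟩, (hval x).2⟩, id⟩
    fun a b h => Subtype.ext (congrArg (fun x => x.1.1) h)

theorem TwoIndepSet.insert {W : Type*} {G : SimpleGraph W} {S : Set W} {x : W}
    (hS : TwoIndepSet G S) (hadj : ∀ y ∈ S, ¬G.Adj x y)
    (hcommon : ∀ y ∈ S, ∀ w, G.Adj x w → ¬G.Adj w y) : TwoIndepSet G (insert x S) := by
  rintro a (rfl | ha) b (rfl | hb) hab
  · exact absurd rfl hab
  · exact ⟨hadj b hb, fun w hw => hcommon b hb w hw.1 hw.2⟩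
  · exact ⟨fun h => hadj a ha h.symm, fun w hw => hcommon a ha w hw.2.symm hw.1.symm⟩
  · exact hS a ha b hb hab

/-- A 2-independent set of an induced subgraph on `U` stays 2-independent in the whole graph
if every vertex outside `U` has at most one neighbor in `U`. -/
theorem TwoIndepSet.image_val {W : Type*} {G : SimpleGraph W} {U : Set W} {S : Set U}
    (hS : TwoIndepSet (G.induce U) S)
    (hU : ∀ w ∉ U, ∀ a ∈ U, ∀ b ∈ U, G.Adj w a → G.Adj w b → a = b) :
    TwoIndepSet G (Subtype.val '' S) := by
  rintro _ ⟨a, ha, rfl⟩ _ ⟨b, hb, rfl⟩ hab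
  obtain ⟨h1, h2⟩ := hS a ha b hb fun h => hab (congrArg _ h)
  refine ⟨h1, fun w hw => ?_⟩
  by_cases hwU : w ∈ U
  · exact h2 ⟨w, hwU⟩ hw
  · exact hab (hU w hwU a a.2 b b.2 hw.1.symm hw.2)

theorem SimpleGraph.mem_of_adj_of_degree_le {W : Type*} {G : SimpleGraph W} {a : W}
    [Fintype (G.neighborSet a)] {s : Finset W} (hs : ∀ x ∈ s, G.Adj a x)
    (hcard : G.degree a ≤ s.card) {x : W} (hx : G.Adj a x) : x ∈ s := by
  have hsub : s ⊆ G.neighborFinset a := fun y hy => (G.mem_neighborFinset a y).2 (hs y hy)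
  rw [Finset.eq_of_subset_of_card_le hsub hcard]
  exact (G.mem_neighborFinset a x).2 hx

theorem SimpleGraph.eq_or_eq_of_degree_eq_two {W : Type*} {G : SimpleGraph W} {a b c : W}
    [Fintype (G.neighborSet a)] (hd : G.degree a = 2) (hb : G.Adj a b) (hc : G.Adj a c)
    (hbc : b ≠ c) : ∀ x, G.Adj a x → x = b ∨ x = c := by
  intro x hx
  have := SimpleGraph.mem_of_adj_of_degree_le (s := {b, c}) (by simp [hb, hc])
    (by rw [hd, Finset.card_pair hbc]) hx
  simpa using this

theorem SimpleGraph.exists_other_adj_of_degree_eq_two {W : Type*} {G : SimpleGraph W} {a b : W}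
    [Fintype (G.neighborSet a)] (hd : G.degree a = 2) (hb : G.Adj a b) :
    ∃ c, c ≠ b ∧ G.Adj a c ∧ ∀ x, G.Adj a x → x = b ∨ x = c := by
  obtain ⟨c, hc, hcb⟩ : ∃ c ∈ G.neighborFinset a, c ≠ b :=
    Finset.exists_mem_ne (by rw [SimpleGraph.card_neighborFinset_eq_degree, hd]; norm_num) b
  rw [SimpleGraph.mem_neighborFinset] at hc
  exact ⟨c, hcb, hc, SimpleGraph.eq_or_eq_of_degree_eq_two hd hb hc hcb.symm⟩

/-- A star with center `v` and leaves `a`, `b`, `c`, `t` attached to an induced forest on `F`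
through at most the one vertex `c` gives again an induced forest. -/
theorem SimpleGraph.IsAcyclic.induce_insert_star {W : Type*} {G : SimpleGraph W} {F : Set W}
    {v t s a b c wa wb wc : W} (hF : (G.induce F).IsAcyclic)
    (hv : ∀ x ∈ F, ¬G.Adj v x) (hvF : v ∉ F)
    (ha : ∀ x, G.Adj a x → x = v ∨ x = wa) (hb : ∀ x, G.Adj b x → x = v ∨ x = wb)
    (hc : ∀ x, G.Adj c x → x = v ∨ x = wc) (ht : ∀ x, G.Adj t x → x = v ∨ x = s)
    (hwa : wa ∉ insert c F) (hwb : wb ∉ insert a (insert c F))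
    (hs : s ∉ insert b (insert a (insert c F))) :
    (G.induce (F ∪ {v, t, a, b, c})).IsAcyclic := by
  have heq : F ∪ {v, t, a, b, c} = insert t (insert b (insert a (insert v (insert c F)))) := by
    ext x
    simp only [Set.mem_union, Set.mem_insert_iff, Set.mem_singleton_iff]
    tauto
  rw [heq]
  simp only [Set.mem_insert_iff, not_or] at hwa hwb hs
  refine ((((hF.induce_insert ?_).induce_insert ?_).induce_insert ?_).induce_insert
    ?_).induce_insert ?_ <;> intro x hx y hy hx' hy' <;>
    (try simp only [Set.mem_insert_iff] at hx hy) <;> grind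

/-- [C'4] If `v` is a 5-vertex on one pendent triangle `v t1 t2` whose remaining three
neighbors `u1, u2, u3` are 2-vertices not on pendent triangles (their two neighbors are
non-adjacent), and `G − {v, t1, t2, u1, u2, u3}` has an FII-partition, then so does `G`. -/
theorem hasFIIPartition_of_five_vertex_one_triangle {V : Type*} [Fintype V]
    (G : SimpleGraph V) (v t1 t2 u1 u2 u3 : V)
    (hne : List.Pairwise (· ≠ ·) [v, t1, t2, u1, u2, u3])
    (ht1 : G.Adj v t1) (ht2 : G.Adj v t2) (h12 : G.Adj t1 t2)
    (hu1 : G.Adj v u1) (hu2 : G.Adj v u2) (hu3 : G.Adj v u3)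
    (hdv : G.degree v = 5)
    (hdt1 : G.degree t1 = 2) (hdt2 : G.degree t2 = 2)
    (hdu1 : G.degree u1 = 2) (hdu2 : G.degree u2 = 2) (hdu3 : G.degree u3 = 2)
    (hu1nt : ∀ a b, G.Adj u1 a → G.Adj u1 b → ¬G.Adj a b)
    (hu2nt : ∀ a b, G.Adj u2 a → G.Adj u2 b → ¬G.Adj a b)
    (hu3nt : ∀ a b, G.Adj u3 a → G.Adj u3 b → ¬G.Adj a b)
    (h : HasFIIPartition (G.induce ({v, t1, t2, u1, u2, u3} : Set V)ᶜ)) :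
    HasFIIPartition G := by
  have hn1 := hne
  simp only [List.pairwise_cons, List.mem_cons, List.not_mem_nil, or_false, forall_eq_or_imp,
    forall_eq] at hn1
  obtain ⟨⟨hvt1, hvt2, hvu1, hvu2, hvu3⟩, ⟨ht12, ht1u1, ht1u2, ht1u3⟩, ⟨ht2u1, ht2u2, ht2u3⟩,
    ⟨hu12, hu13⟩, hu23, -⟩ := hn1
  have nv : ∀ x, G.Adj v x → x = t1 ∨ x = t2 ∨ x = u1 ∨ x = u2 ∨ x = u3 := fun x hx => by
    have := SimpleGraph.mem_of_adj_of_degree_le (s := {t1, t2, u1, u2, u3})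
      (by simp [ht1, ht2, hu1, hu2, hu3]) (by rw [hdv]; simp [*]) hx
    simpa using this
  have nt1 := SimpleGraph.eq_or_eq_of_degree_eq_two hdt1 ht1.symm h12 hvt2
  have nt2 := SimpleGraph.eq_or_eq_of_degree_eq_two hdt2 ht2.symm h12.symm hvt1
  obtain ⟨w1, hw1v, hw1, nu1⟩ := SimpleGraph.exists_other_adj_of_degree_eq_two hdu1 hu1.symm
  obtain ⟨w2, hw2v, hw2, nu2⟩ := SimpleGraph.exists_other_adj_of_degree_eq_two hdu2 hu2.symm
  obtain ⟨w3, hw3v, hw3, nu3⟩ := SimpleGraph.exists_other_adj_of_degree_eq_two hdu3 hu3.symm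
  have nvw1 : ¬G.Adj v w1 := hu1nt v w1 hu1.symm hw1
  have nvw2 : ¬G.Adj v w2 := hu2nt v w2 hu2.symm hw2
  have nvw3 : ¬G.Adj v w3 := hu3nt v w3 hu3.symm hw3
  obtain ⟨U, hU⟩ : ∃ U : Set V, U = ({v, t1, t2, u1, u2, u3} : Set V)ᶜ := ⟨_, rfl⟩
  rw [← hU] at h
  obtain ⟨F', A', B', hcov', hFA', hFB', hAB', hF', hA', hB'⟩ := h
  have memU : ∀ x, x ∈ U ↔ ¬(x = v ∨ x = t1 ∨ x = t2 ∨ x = u1 ∨ x = u2 ∨ x = u3) := fun x => by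
    simp [hU]
  have hout : ∀ w ∉ U, ∀ a ∈ U, ∀ b ∈ U, G.Adj w a → G.Adj w b → a = b := by
    intro w hw a ha b hb hwa hwb
    rw [memU] at hw ha hb
    grind
  have sub : ∀ S : Set U, ∀ x ∈ Subtype.val '' S, x ∈ U := by
    rintro S _ ⟨y, -, rfl⟩
    exact y.2
  have hcov : ∀ x ∈ U, x ∈ Subtype.val '' F' ∨ x ∈ Subtype.val '' A' ∨ x ∈ Subtype.val '' B' :=
    fun x hx => by simpa [hx] using hcov' ⟨x, hx⟩
  have hdisj : ∀ S T : Set U, Disjoint S T →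
      ∀ x ∈ Subtype.val '' S, x ∉ Subtype.val '' T := fun S T hST x hx hx' =>
    Set.disjoint_left.1 ((Set.disjoint_image_iff Subtype.val_injective).2 hST) hx hx'
  have hFA := hdisj _ _ hFA'
  have hFB := hdisj _ _ hFB'
  have hAB := hdisj _ _ hAB'
  have hFU := sub F'
  have hAU := sub A'
  have hBU := sub B'
  replace hF' := hF'.induce_image_val
  replace hA' := hA'.image_val hout
  replace hB' := hB'.image_val hout
  generalize Subtype.val '' F' = F at *
  generalize Subtype.val '' A' = A at *
  generalize Subtype.val '' B' = B at *
  clear hdisj sub hcov' hFA' hFB' hAB' F' A' B' hU hout hne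
  simp only [memU] at hFU hAU hBU hcov
  have center : ∀ A B : Set V, TwoIndepSet G A → TwoIndepSet G B →
      (∀ x ∈ F, x ∉ A) → (∀ x ∈ F, x ∉ B) → (∀ x ∈ A, x ∉ B) →
      (∀ x ∈ A, x ∈ U) → (∀ x ∈ B, x ∈ U) → (∀ x ∈ U, x ∈ F ∨ x ∈ A ∨ x ∈ B) →
      w1 ∉ A → w2 ∉ A → w3 ∉ A → HasFIIPartition G := by
    intro A B hA hB hFA hFB hAB hAU hBU hcov h1 h2 h3
    simp only [memU] at hAU hBU hcov
    refine ⟨insert t2 (insert t1 (insert u3 (insert u2 (insert u1 F)))), insert v A, B,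
      ?_, ?_, ?_, ?_, ?_, hA.insert ?_ ?_, hB⟩
    · intro x
      simp only [Set.mem_insert_iff]
      grind
    · rw [Set.disjoint_left]
      intro x
      simp only [Set.mem_insert_iff]
      grind
    · rw [Set.disjoint_left]
      intro x
      simp only [Set.mem_insert_iff]
      grind
    · rw [Set.disjoint_left]
      intro x
      simp only [Set.mem_insert_iff]
      grind
    · refine ((((hF'.induce_insert ?_).induce_insert ?_).induce_insert ?_).induce_insert
        ?_).induce_insert ?_ <;> intro x hx y hy hx' hy' <;>
        (try simp only [Set.mem_insert_iff] at hx hy) <;> grind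
    · grind
    · grind
  by_cases hnA : w1 ∉ A ∧ w2 ∉ A ∧ w3 ∉ A
  · exact center A B hA' hB' hFA hFB hAB (by simpa only [memU]) (by simpa only [memU])
      (by simpa only [memU]) hnA.1 hnA.2.1 hnA.2.2
  by_cases hnB : w1 ∉ B ∧ w2 ∉ B ∧ w3 ∉ B
  · refine center B A hB' hA' hFB hFA (fun x hB hA => hAB x hA hB) (by simpa only [memU])
      (by simpa only [memU]) ?_ hnB.1 hnB.2.1 hnB.2.2
    simp only [memU]
    exact fun x hx => by have := hcov x hx; tauto
  have hvF : v ∉ F := fun h => hFU v h (Or.inl rfl)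
  have hvadj : ∀ x ∈ F, ¬G.Adj v x := fun x hx hadj => hFU x hx (Or.inr (nv x hadj))
  have hforest : (G.induce (F ∪ {v, t2, u1, u2, u3})).IsAcyclic := by
    have hpair : (w1 ∉ F ∧ w2 ∉ F) ∨ (w1 ∉ F ∧ w3 ∉ F) ∨ (w2 ∉ F ∧ w3 ∉ F) := by
      grind
    rcases hpair with ⟨h1, h2⟩ | ⟨h1, h2⟩ | ⟨h1, h2⟩
    · have := hF'.induce_insert_star (t := t2) hvadj hvF nu1 nu2 nu3 nt2
        (by simp only [Set.mem_insert_iff]; grind) (by simp only [Set.mem_insert_iff]; grind)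
        (by simp only [Set.mem_insert_iff]; grind)
      exact this
    · have := hF'.induce_insert_star (t := t2) hvadj hvF nu1 nu3 nu2 nt2
        (by simp only [Set.mem_insert_iff]; grind) (by simp only [Set.mem_insert_iff]; grind)
        (by simp only [Set.mem_insert_iff]; grind)
      rwa [Set.pair_comm u3 u2] at this
    · have := hF'.induce_insert_star (t := t2) hvadj hvF nu2 nu3 nu1 nt2
        (by simp only [Set.mem_insert_iff]; grind) (by simp only [Set.mem_insert_iff]; grind)
        (by simp only [Set.mem_insert_iff]; grind)
      rwa [Set.pair_comm u3 u1, Set.insert_comm u2 u1] at this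
  refine ⟨F ∪ {v, t2, u1, u2, u3}, insert t1 A, B, ?_, ?_, ?_, ?_, hforest, hA'.insert ?_ ?_, hB'⟩
  · intro x
    simp only [Set.mem_union, Set.mem_insert_iff, Set.mem_singleton_iff]
    grind
  · rw [Set.disjoint_left]
    intro x
    simp only [Set.mem_union, Set.mem_insert_iff, Set.mem_singleton_iff]
    grind
  · rw [Set.disjoint_left]
    intro x
    simp only [Set.mem_union, Set.mem_insert_iff, Set.mem_singleton_iff]
    grind
  · rw [Set.disjoint_left]
    intro x
    simp only [Set.mem_insert_iff]
    grind
  · grind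
  · grind
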